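/- Fix 0 < δ < 1/2, λ > 0, and 0 < l ≤ ∞, and for m > 0 define f(m) = inf { F_{λ,δ,l}(Ω) : Ω ⊂ ℝ² of finite perimeter, |Ω| = m } − (6πλ/(5|log δ| l)) m. Suppose f(m₀) = 0 for some m₀ > 0 and a minimizer Ω with |Ω| = m₀ exists. Then f(m̃) < 0 for all m̃ > m₀, and f is strictly decreasing on (m₀, ∞). -/

import Mathlib

open MeasureTheory Real Filter Set
open scoped ENNReal

noncomputable section

/-- The plane `ℝ²`. -/
abbrev Plane := EuclideanSpace ℝ (Fin 2)

/-- Divergence of a vector field on the plane. -/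
def divg (φ : Plane → Plane) (x : Plane) : ℝ :=
  ∑ i : Fin 2, fderiv ℝ φ x (EuclideanSpace.single i 1) i

/-- The set of values `∫_Ω div φ` over admissible test vector fields. -/
def perimVals (Ω : Set Plane) : Set ℝ :=
  {s | ∃ φ : Plane → Plane, ContDiff ℝ 1 φ ∧ HasCompactSupport φ ∧
        (∀ x, ‖φ x‖ ≤ 1) ∧ s = ∫ x in Ω, divg φ x}

/-- The De Giorgi perimeter of a set in the plane. -/
def perim (Ω : Set Plane) : ℝ := sSup (perimVals Ω)

/-- A set has finite perimeter if the defining supremum is finite. -/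
def HasFinPer (Ω : Set Plane) : Prop := BddAbove (perimVals Ω)

/-- The cutoff function `g_δ(r) = χ_{(δ,∞)}(r)`. -/
def gdel (δ r : ℝ) : ℝ := if δ < r then 1 else 0

/-- Characteristic function of a set. -/
def ind (Ω : Set Plane) : Plane → ℝ := Set.indicator Ω 1

/-- The (rescaled) nonlocal dipolar term. -/
def nlE (δ : ℝ) (Ω : Set Plane) : ℝ :=
  ∫ x : Plane, ∫ z : Plane, |ind Ω (x + z) - ind Ω x| ^ 2 * (gdel δ ‖z‖ / ‖z‖ ^ 3)

/-- The energy `E_{λ,δ}`. -/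
def Eenergy (lam δ : ℝ) (Ω : Set Plane) : ℝ :=
  perim Ω - lam / (4 * |Real.log δ|) * nlE δ Ω

end

noncomputable section

/-- The kernel `K_{δ,l}` (the dipolar correction is interpreted as `0` when `l = ∞`). -/
def Kker (δ : ℝ) (l : ℝ≥0∞) (r : ℝ) : ℝ :=
  gdel δ r / r ^ 3 -
    (if l = ⊤ then 0
      else (r ^ 2 - 2 * l.toReal ^ 2) / (r ^ 2 + l.toReal ^ 2) ^ ((5 : ℝ) / 2))

/-- The energy `F_{λ,δ,l}`. -/
def Fenergy (lam δ : ℝ) (l : ℝ≥0∞) (Ω : Set Plane) : ℝ :=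
  perim Ω - lam / (4 * |Real.log δ|) *
    ∫ x : Plane, ∫ z : Plane, |ind Ω (x + z) - ind Ω x| ^ 2 * Kker δ l ‖z‖

/-- The linear correction constant `6πλ/(5|log δ| l)` (zero when `l = ∞`). -/
def cconst (lam δ : ℝ) (l : ℝ≥0∞) : ℝ :=
  if l = ⊤ then 0 else 6 * Real.pi * lam / (5 * |Real.log δ| * l.toReal)

/-- The function `f(m) = inf F_{λ,δ,l} − (6πλ/(5|log δ| l)) m`. -/
def fmin (lam δ : ℝ) (l : ℝ≥0∞) (m : ℝ) : ℝ :=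
  sInf {s | ∃ Ω : Set Plane, MeasurableSet Ω ∧ HasFinPer Ω ∧
      volume Ω = ENNReal.ofReal m ∧ s = Fenergy lam δ l Ω} - cconst lam δ l * m

end

open scoped Pointwise in
theorem perim_smul_le {Ω : Set Plane} (hfin : HasFinPer Ω) {t : ℝ} (ht : 0 < t) :
    HasFinPer (t • Ω) ∧ perim (t • Ω) ≤ t * perim Ω := by
  have key : ∀ s ∈ perimVals (t • Ω), s ≤ t * perim Ω := by
    rintro s ⟨φ, hφ, hc, hb, rfl⟩
    have hmem : ∫ x in Ω, divg (fun y => φ (t • y)) x ∈ perimVals Ω := by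
      refine ⟨fun y => φ (t • y), hφ.comp (contDiff_const_smul t), ?_, fun x => hb _, rfl⟩
      exact hc.comp_homeomorph (Homeomorph.smulOfNeZero t ht.ne')
    have hdiv : ∀ x, divg (fun y => φ (t • y)) x = t * divg φ (t • x) := by
      intro x
      simp only [divg, Finset.mul_sum]
      refine Finset.sum_congr rfl fun i _ => ?_
      rw [fderiv_comp_smul]
      simp
    have hscale : ∫ x in t • Ω, divg φ x = t * ∫ x in Ω, divg (fun y => φ (t • y)) x := by
      have h := Measure.setIntegral_comp_smul (volume : Measure Plane) (divg φ) ht.ne' (s := Ω)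
      simp only [finrank_euclideanSpace, Fintype.card_fin, smul_eq_mul] at h
      simp only [hdiv, integral_const_mul, h, abs_of_pos (inv_pos.2 (pow_pos ht 2))]
      field_simp
    rw [hscale]
    exact mul_le_mul_of_nonneg_left (le_csSup hfin hmem) ht.le
  refine ⟨⟨_, key⟩, csSup_le ?_ key⟩
  exact ⟨_, 0, contDiff_const, HasCompactSupport.zero, by simp, rfl⟩

theorem perim_nonneg {Ω : Set Plane} (hfin : HasFinPer Ω) : 0 ≤ perim Ω := by
  refine le_csSup hfin ⟨0, contDiff_const, HasCompactSupport.zero, by simp, ?_⟩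
  simp [divg]

/-- The measure of `(Ω - z) ∆ Ω`, as an integral. -/
noncomputable def shiftDiff (Ω : Set Plane) (z : Plane) : ℝ := ∫ x : Plane, |ind Ω (x + z) - ind Ω x| ^ 2

theorem measurable_ind {Ω : Set Plane} (hΩ : MeasurableSet Ω) : Measurable (ind Ω) :=
  measurable_one.indicator hΩ

theorem integrable_ind {Ω : Set Plane} (hΩ : MeasurableSet Ω) (hv : volume Ω ≠ ⊤) :
    Integrable (ind Ω) :=
  (integrable_indicator_iff hΩ).2 (integrableOn_const hv)

theorem integral_ind {Ω : Set Plane} (hΩ : MeasurableSet Ω) :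
    ∫ x, ind Ω x = volume.real Ω := by
  simp [ind, integral_indicator_one hΩ]

theorem sq_abs_ind_sub_le (Ω : Set Plane) (x z : Plane) :
    |ind Ω (x + z) - ind Ω x| ^ 2 ≤ ind Ω (x + z) + ind Ω x := by
  by_cases h1 : x + z ∈ Ω <;> by_cases h2 : x ∈ Ω <;> simp [ind, h1, h2]

theorem measurable_uncurry_sq_ind_sub {Ω : Set Plane} (hΩ : MeasurableSet Ω) :
    Measurable fun p : Plane × Plane => |ind Ω (p.1 + p.2) - ind Ω p.1| ^ 2 := by
  have := measurable_ind hΩ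
  have h1 : Measurable fun p : Plane × Plane => ind Ω (p.1 + p.2) :=
    this.comp (measurable_fst.add measurable_snd)
  have h2 : Measurable fun p : Plane × Plane => ind Ω p.1 := this.comp measurable_fst
  exact ((h1.sub h2).abs).pow_const 2

theorem integrable_sq_ind_sub {Ω : Set Plane} (hΩ : MeasurableSet Ω) (hv : volume Ω ≠ ⊤)
    (z : Plane) : Integrable fun x => |ind Ω (x + z) - ind Ω x| ^ 2 := by
  have h := integrable_ind hΩ hv
  refine ((h.comp_add_right z).add h).mono' ?_ (Eventually.of_forall fun x => ?_)
  · exact ((measurable_uncurry_sq_ind_sub hΩ).comp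
      (measurable_id.prodMk measurable_const)).aestronglyMeasurable
  · rw [Real.norm_of_nonneg (by positivity)]
    exact sq_abs_ind_sub_le Ω x z

theorem shiftDiff_nonneg (Ω : Set Plane) (z : Plane) : 0 ≤ shiftDiff Ω z :=
  integral_nonneg fun _ => by positivity

theorem shiftDiff_le {Ω : Set Plane} (hΩ : MeasurableSet Ω) (hv : volume Ω ≠ ⊤) (z : Plane) :
    shiftDiff Ω z ≤ 2 * volume.real Ω := by
  have h := integrable_ind hΩ hv
  calc shiftDiff Ω z ≤ ∫ x, (ind Ω (x + z) + ind Ω x) :=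
        integral_mono (integrable_sq_ind_sub hΩ hv z) ((h.comp_add_right z).add h)
          fun x => sq_abs_ind_sub_le Ω x z
    _ = 2 * volume.real Ω := by
        rw [integral_add (h.comp_add_right z) h, integral_add_right_eq_self (ind Ω) z,
          integral_ind hΩ]
        ring

theorem measurable_shiftDiff {Ω : Set Plane} (hΩ : MeasurableSet Ω) :
    AEStronglyMeasurable (shiftDiff Ω) := by
  have := (measurable_uncurry_sq_ind_sub hΩ).stronglyMeasurable
  exact (this.integral_prod_left (μ := (volume : Measure Plane))).aestronglyMeasurable

theorem integrable_shiftDiff_mul {Ω : Set Plane} (hΩ : MeasurableSet Ω) (hv : volume Ω ≠ ⊤)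
    {k : Plane → ℝ} (hk : Integrable k) : Integrable fun z => shiftDiff Ω z * k z := by
  refine hk.bdd_mul (measurable_shiftDiff hΩ) (c := 2 * volume.real Ω)
    (Eventually.of_forall fun z => ?_)
  rw [Real.norm_of_nonneg (shiftDiff_nonneg Ω z)]
  exact shiftDiff_le hΩ hv z

theorem integral_sq_ind_sub_mul {Ω : Set Plane} (hΩ : MeasurableSet Ω) (hv : volume Ω ≠ ⊤)
    {k : Plane → ℝ} (hk : Integrable k) :
    ∫ x : Plane, ∫ z : Plane, |ind Ω (x + z) - ind Ω x| ^ 2 * k z =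
      ∫ z, shiftDiff Ω z * k z := by
  rw [integral_integral_swap]
  · simp only [integral_mul_const, shiftDiff]
  · have hm : AEStronglyMeasurable (fun p : Plane × Plane =>
        |ind Ω (p.1 + p.2) - ind Ω p.1| ^ 2 * k p.2) (volume.prod volume) :=
      (measurable_uncurry_sq_ind_sub hΩ).aestronglyMeasurable.mul hk.1.comp_snd
    refine (integrable_prod_iff' hm).2 ⟨Eventually.of_forall fun z => ?_, ?_⟩
    · exact (integrable_sq_ind_sub hΩ hv z).mul_const (k z)
    · refine (integrable_shiftDiff_mul hΩ hv hk.norm).congr (Eventually.of_forall fun z => ?_)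
      simp only [norm_mul, norm_pow, Real.norm_eq_abs, abs_abs, integral_mul_const,
        shiftDiff]

theorem shiftDiff_pos {Ω : Set Plane} (hΩ : MeasurableSet Ω) (hv : volume Ω ≠ ⊤)
    (hv0 : volume Ω ≠ 0) {z : Plane} (hz : z ≠ 0) : 0 < shiftDiff Ω z := by
  refine (shiftDiff_nonneg Ω z).lt_of_ne' fun h0 => ?_
  have hae : ∀ᵐ x, (x + z ∈ Ω ↔ x ∈ Ω) := by
    have h := (integral_eq_zero_iff_of_nonneg (fun _ => by positivity)
      (integrable_sq_ind_sub hΩ hv z)).1 h0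
    filter_upwards [h] with x hx
    by_cases h1 : x + z ∈ Ω <;> by_cases h2 : x ∈ Ω <;> simp_all [ind]
  have hiter : ∀ n : ℕ, ∀ᵐ x, (x + (n : ℝ) • z ∈ Ω ↔ x ∈ Ω) := by
    intro n
    induction n with
    | zero => simp
    | succ n ih =>
      have hs := (measurePreserving_add_right volume ((n : ℝ) • z)).quasiMeasurePreserving.ae hae
      filter_upwards [ih, hs] with x h1 h2
      rw [← h1, ← h2]
      simp [add_smul, add_assoc]
  obtain ⟨K, hKΩ, hK, hlt⟩ := hΩ.exists_isCompact_lt_add hv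
    (ε := volume Ω / 2) (by simpa using hv0)
  obtain ⟨R, hR⟩ := hK.isBounded.subset_ball 0
  obtain ⟨n, hn⟩ := exists_nat_gt (2 * R / ‖z‖)
  have hzpos : 0 < ‖z‖ := norm_pos_iff.2 hz
  rw [div_lt_iff₀ hzpos] at hn
  set T : Set Plane := (fun x => x + (n : ℝ) • z) ⁻¹' K with hT
  have hvT : volume T = volume K :=
    (measurePreserving_add_right volume ((n : ℝ) • z)).measure_preimage
      hK.measurableSet.nullMeasurableSet
  have hTΩ : volume (T \ Ω) = 0 := by
    refine measure_mono_null ?_ (hiter n)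
    rintro x ⟨h1, h2⟩ h3
    exact h2 (h3.1 (hKΩ h1))
  have hdisj : Disjoint T K := by
    rw [Set.disjoint_left]
    intro x h1 h2
    have a1 := hR h1
    have a2 := hR h2
    simp only [mem_ball_zero_iff] at a1 a2
    have : ‖(n : ℝ) • z‖ ≤ ‖x + (n : ℝ) • z‖ + ‖x‖ := by
      simpa using norm_sub_le (x + (n : ℝ) • z) x
    rw [norm_smul, Real.norm_natCast] at this
    linarith
  have hle : volume K + volume K ≤ volume Ω := by
    calc volume K + volume K = volume (T ∪ K) := by
          rw [measure_union hdisj hK.measurableSet, hvT]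
      _ ≤ volume (Ω ∪ T \ Ω) := measure_mono fun x hx => by
          by_cases h : x ∈ Ω
          · exact Or.inl h
          · rcases hx with hx | hx
            · exact Or.inr ⟨hx, h⟩
            · exact absurd (hKΩ hx) h
      _ ≤ volume Ω + volume (T \ Ω) := measure_union_le _ _
      _ = volume Ω := by rw [hTΩ, add_zero]
  have hKt : volume K ≠ ⊤ := ne_top_of_le_ne_top hv (measure_mono hKΩ)
  rw [← ENNReal.ofReal_toReal hv, ← ENNReal.ofReal_toReal hKt] at hlt hle
  have h2 : ENNReal.ofReal (volume Ω).toReal / 2 = ENNReal.ofReal ((volume Ω).toReal / 2) := by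
    rw [ENNReal.ofReal_div_of_pos two_pos]; simp
  rw [h2, ← ENNReal.ofReal_add (by positivity) (by positivity),
    ENNReal.ofReal_lt_ofReal_iff_of_nonneg (by positivity)] at hlt
  rw [← ENNReal.ofReal_add (by positivity) (by positivity),
    ENNReal.ofReal_le_ofReal_iff (by positivity)] at hle
  linarith

theorem integrable_norm_of_bound {f : ℝ → ℝ} (hf : Measurable f) {C : ℝ}
    (hC : ∀ r, 0 ≤ r → |f r| ≤ C / (1 + r) ^ 3) : Integrable fun z : Plane => f ‖z‖ := by
  have h : Integrable (fun z : Plane => (1 + ‖z‖) ^ (-(3 : ℝ))) :=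
    integrable_one_add_norm (by simp; norm_num)
  refine (h.const_mul C).mono' (hf.comp measurable_norm).aestronglyMeasurable
    (Eventually.of_forall fun z => ?_)
  rw [Real.norm_eq_abs, Real.rpow_neg (by positivity)]
  have h3 : (1 + ‖z‖) ^ (3 : ℝ) = (1 + ‖z‖) ^ 3 := by
    rw [← Real.rpow_natCast]; norm_num
  rw [h3, ← div_eq_mul_inv]
  exact hC _ (norm_nonneg z)

theorem measurable_gdel (δ : ℝ) : Measurable (gdel δ) :=
  Measurable.ite measurableSet_Ioi measurable_const measurable_const

theorem integrable_gdel_div {δ : ℝ} (hδ : 0 < δ) :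
    Integrable fun z : Plane => gdel δ ‖z‖ / ‖z‖ ^ 3 := by
  refine integrable_norm_of_bound (f := fun r => gdel δ r / r ^ 3) (C := (1 + 1 / δ) ^ 3)
    ((measurable_gdel δ).div (measurable_id.pow_const 3)) fun r hr => ?_
  by_cases h : δ < r
  · have hr0 : 0 < r := hδ.trans h
    simp only [gdel, h, if_true]
    rw [abs_of_pos (by positivity), div_le_div_iff₀ (by positivity) (by positivity), one_mul,
      ← mul_pow]
    refine pow_le_pow_left₀ (by positivity) ?_ 3
    have : 1 ≤ r / δ := (one_le_div hδ).2 h.le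
    calc 1 + r ≤ r / δ + r := by linarith
      _ = (1 + 1 / δ) * r := by ring
  · simp only [gdel, h, if_false, zero_div, abs_zero]
    positivity

theorem one_add_le_mul_sqrt {L : ℝ} (hL : 0 < L) (r : ℝ) :
    1 + r ≤ (1 + 1 / L) * √(r ^ 2 + L ^ 2) := by
  have h1 : r ≤ √(r ^ 2 + L ^ 2) := Real.le_sqrt_of_sq_le (by nlinarith)
  have h2 : L ≤ √(r ^ 2 + L ^ 2) := Real.le_sqrt_of_sq_le (by nlinarith)
  have h3 : 1 ≤ √(r ^ 2 + L ^ 2) / L := (one_le_div hL).2 h2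
  calc 1 + r ≤ √(r ^ 2 + L ^ 2) / L + √(r ^ 2 + L ^ 2) := by linarith
    _ = _ := by ring

theorem rpow_five_halves (x : ℝ) (hx : 0 ≤ x) : x ^ ((5 : ℝ) / 2) = √x ^ 5 := by
  rw [Real.sqrt_eq_rpow, ← Real.rpow_natCast, ← Real.rpow_mul hx]
  norm_num

theorem integrable_quadratic_div {L : ℝ} (hL : 0 < L) (a b : ℝ) :
    Integrable fun z : Plane =>
      (a * ‖z‖ ^ 2 + b * L ^ 2) / (‖z‖ ^ 2 + L ^ 2) ^ ((5 : ℝ) / 2) := by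
  refine integrable_norm_of_bound
    (f := fun r => (a * r ^ 2 + b * L ^ 2) / (r ^ 2 + L ^ 2) ^ ((5 : ℝ) / 2))
    (C := (|a| + |b|) * (1 + 1 / L) ^ 3) (by fun_prop) fun r hr => ?_
  have hpos : 0 < √(r ^ 2 + L ^ 2) := Real.sqrt_pos.2 (by positivity)
  rw [rpow_five_halves _ (by positivity), abs_div, abs_of_pos (pow_pos hpos 5)]
  have hsq : √(r ^ 2 + L ^ 2) ^ 2 = r ^ 2 + L ^ 2 := Real.sq_sqrt (by positivity)
  have hle := one_add_le_mul_sqrt hL r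
  set s := √(r ^ 2 + L ^ 2)
  have hnum : |a * r ^ 2 + b * L ^ 2| ≤ (|a| + |b|) * s ^ 2 := by
    calc |a * r ^ 2 + b * L ^ 2| ≤ |a * r ^ 2| + |b * L ^ 2| := abs_add_le _ _
      _ = |a| * r ^ 2 + |b| * L ^ 2 := by simp [abs_mul]
      _ ≤ (|a| + |b|) * s ^ 2 := by
        rw [hsq]
        nlinarith [mul_nonneg (abs_nonneg a) (sq_nonneg L), mul_nonneg (abs_nonneg b) (sq_nonneg r)]
  have hc : (1 + r) ^ 3 ≤ (1 + 1 / L) ^ 3 * s ^ 3 := by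
    rw [← mul_pow]
    exact pow_le_pow_left₀ (by positivity) hle 3
  rw [div_le_div_iff₀ (by positivity) (by positivity)]
  calc |a * r ^ 2 + b * L ^ 2| * (1 + r) ^ 3
      ≤ ((|a| + |b|) * s ^ 2) * ((1 + 1 / L) ^ 3 * s ^ 3) := by gcongr
    _ = _ := by ring

theorem integral_majorant {L : ℝ} (hL : 0 < L) :
    ∫ z : Plane, (9 / 5 * ‖z‖ ^ 2 + 0 * L ^ 2) / (‖z‖ ^ 2 + L ^ 2) ^ ((5 : ℝ) / 2) =
      12 * π / (5 * L) := by
  have hpos : ∀ r : ℝ, 0 < √(r ^ 2 + L ^ 2) := fun r => Real.sqrt_pos.2 (by positivity)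
  have hsq : ∀ r : ℝ, √(r ^ 2 + L ^ 2) ^ 2 = r ^ 2 + L ^ 2 := fun r =>
    Real.sq_sqrt (by positivity)
  have hderiv : ∀ r ∈ Ici (0 : ℝ), HasDerivAt
      (fun r => 9 / 5 * (L ^ 2 / 3 * (√(r ^ 2 + L ^ 2))⁻¹ ^ 3 - (√(r ^ 2 + L ^ 2))⁻¹))
      (r ^ 1 • ((9 / 5 * r ^ 2 + 0 * L ^ 2) / (r ^ 2 + L ^ 2) ^ ((5 : ℝ) / 2))) r := by
    intro r _
    have h1 : HasDerivAt (fun r : ℝ => √(r ^ 2 + L ^ 2)) (2 * r / (2 * √(r ^ 2 + L ^ 2))) r := by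
      have := ((hasDerivAt_pow 2 r).add_const (L ^ 2)).sqrt (by positivity)
      simpa using this
    have h2 := h1.inv (hpos r).ne'
    have h3 := (((h2.pow 3).const_mul (L ^ 2 / 3)).sub h2).const_mul (9 / 5)
    refine h3.congr_deriv ?_
    rw [rpow_five_halves _ (by positivity)]
    have hs := hsq r
    have hp := (hpos r).ne'
    have hL2 : L ^ 2 = √(r ^ 2 + L ^ 2) ^ 2 - r ^ 2 := by linarith
    simp only [Pi.inv_apply, smul_eq_mul, Nat.add_one_sub_one, inv_pow]
    generalize √(r ^ 2 + L ^ 2) = s at *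
    rw [hL2]
    field_simp
    ring
  have htend : Tendsto
      (fun r => 9 / 5 * (L ^ 2 / 3 * (√(r ^ 2 + L ^ 2))⁻¹ ^ 3 - (√(r ^ 2 + L ^ 2))⁻¹))
      atTop (nhds 0) := by
    have h0 : Tendsto (fun r : ℝ => √(r ^ 2 + L ^ 2)) atTop atTop := by
      refine tendsto_atTop_mono (fun r => ?_) tendsto_id
      exact Real.le_sqrt_of_sq_le (by simp; positivity)
    have h1 := tendsto_inv_atTop_zero.comp h0
    have h2 := (((h1.pow 3).const_mul (L ^ 2 / 3)).sub h1).const_mul (9 / 5)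
    simpa using h2
  rw [integral_fun_norm_addHaar volume
    (fun r => (9 / 5 * r ^ 2 + 0 * L ^ 2) / (r ^ 2 + L ^ 2) ^ ((5 : ℝ) / 2))]
  simp only [finrank_euclideanSpace, Fintype.card_fin, Nat.add_one_sub_one]
  rw [integral_Ioi_of_hasDerivAt_of_nonneg' hderiv (fun r hr => ?_) htend]
  · simp only [Measure.real, EuclideanSpace.volume_ball_fin_two]
    simp [Real.sqrt_sq hL.le, ENNReal.toReal_ofReal pi_pos.le]
    field_simp
    ring
  · have : (0 : ℝ) < r := hr
    simp only [smul_eq_mul]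
    positivity

theorem quadratic_div_scale {L t r : ℝ} (hL : 0 < L) (ht : 0 < t) (hr : 0 < r) (a b : ℝ) :
    t ^ 3 * ((a * (t * r) ^ 2 + b * L ^ 2) / ((t * r) ^ 2 + L ^ 2) ^ ((5 : ℝ) / 2)) =
      b * (√(r ^ 2 + (L / t) ^ 2))⁻¹ ^ 3
        + (a - b) * r ^ 2 * (√(r ^ 2 + (L / t) ^ 2))⁻¹ ^ 5 := by
  have hs : √((t * r) ^ 2 + L ^ 2) = t * √(r ^ 2 + (L / t) ^ 2) := by
    rw [← Real.sqrt_sq ht.le, ← Real.sqrt_mul (by positivity), Real.sqrt_sq ht.le]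
    congr 1
    field_simp
  rw [rpow_five_halves _ (by positivity), hs]
  have hpos : 0 < √(r ^ 2 + (L / t) ^ 2) := Real.sqrt_pos.2 (by positivity)
  have hsq : √(r ^ 2 + (L / t) ^ 2) ^ 2 = r ^ 2 + (L / t) ^ 2 := Real.sq_sqrt (by positivity)
  generalize √(r ^ 2 + (L / t) ^ 2) = s at *
  have hL2 : L ^ 2 = t ^ 2 * (s ^ 2 - r ^ 2) := by rw [hsq]; field_simp; ring
  rw [hL2]
  field_simp
  ring

theorem sqrt_inv_scale_bounds {L t r : ℝ} (hL : 0 < L) (ht : 1 < t) (hr : 0 < r) :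
    0 ≤ (√(r ^ 2 + L ^ 2))⁻¹ ∧
      (√(r ^ 2 + L ^ 2))⁻¹ ≤ (√(r ^ 2 + (L / t) ^ 2))⁻¹ ∧
      r * (√(r ^ 2 + (L / t) ^ 2))⁻¹ ≤ 1 := by
  have ht0 : 0 < t := by linarith
  have h1 : 0 < √(r ^ 2 + (L / t) ^ 2) := Real.sqrt_pos.2 (by positivity)
  refine ⟨by positivity, ?_, ?_⟩
  · refine inv_anti₀ h1 (Real.sqrt_le_sqrt ?_)
    have : L / t ≤ L := div_le_self hL.le ht.le
    gcongr
  · rw [← div_eq_mul_inv, div_le_one h1]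
    exact Real.le_sqrt_of_sq_le (by nlinarith [sq_nonneg (L / t)])

theorem poly_mono {r w W : ℝ} (h0 : 0 ≤ w) (h1 : w ≤ W) (hr : 0 ≤ r) (h2 : r * W ≤ 1) :
    2 * w ^ 3 - 6 / 5 * r ^ 2 * w ^ 5 ≤ 2 * W ^ 3 - 6 / 5 * r ^ 2 * W ^ 5 := by
  have hW : 0 ≤ W := h0.trans h1
  have hrW : (r * W) ^ 2 ≤ 1 := pow_le_one₀ (by positivity) h2
  have hrw : r ^ 2 * w ^ 5 * W ^ 2 ≤ w ^ 5 := by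
    calc r ^ 2 * w ^ 5 * W ^ 2 = w ^ 5 * (r * W) ^ 2 := by ring
      _ ≤ w ^ 5 * 1 := by gcongr
      _ = w ^ 5 := mul_one _
  have key : r ^ 2 * (W ^ 5 - w ^ 5) * 3 ≤ 5 * (W ^ 3 - w ^ 3) := by
    have e1 : W ^ 5 - w ^ 5 =
        (W - w) * (W ^ 4 + W ^ 3 * w + W ^ 2 * w ^ 2 + W * w ^ 3 + w ^ 4) := by
      ring
    have e2 : W ^ 3 - w ^ 3 = (W - w) * (W ^ 2 + W * w + w ^ 2) := by ring
    have hd : 0 ≤ W - w := by linarith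
    have hq : 3 * (W ^ 4 + W ^ 3 * w + W ^ 2 * w ^ 2 + W * w ^ 3 + w ^ 4) ≤
        5 * W ^ 2 * (W ^ 2 + W * w + w ^ 2) := by
      nlinarith [mul_nonneg hd hW, mul_nonneg hd h0, mul_nonneg h0 hW,
        mul_nonneg hd (pow_nonneg hW 3), mul_nonneg hd (mul_nonneg h0 (sq_nonneg W)),
        mul_nonneg hd (mul_nonneg hW (sq_nonneg w)), mul_nonneg hd (pow_nonneg h0 3)]
    calc r ^ 2 * (W ^ 5 - w ^ 5) * 3
        = (W - w) * r ^ 2 * (3 * (W ^ 4 + W ^ 3 * w + W ^ 2 * w ^ 2 + W * w ^ 3 + w ^ 4)) := by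
          rw [e1]; ring
      _ ≤ (W - w) * r ^ 2 * (5 * W ^ 2 * (W ^ 2 + W * w + w ^ 2)) := by gcongr
      _ = (r * W) ^ 2 * ((W - w) * (5 * (W ^ 2 + W * w + w ^ 2))) := by ring
      _ ≤ 1 * ((W - w) * (5 * (W ^ 2 + W * w + w ^ 2))) := by
          refine mul_le_mul_of_nonneg_right hrW ?_
          positivity
      _ = 5 * (W ^ 3 - w ^ 3) := by rw [e2]; ring
  linarith

theorem dipole_scale_le {L t r : ℝ} (hL : 0 < L) (ht : 1 < t) (hr : 0 < r) :
    t ^ 3 * ((1 * (t * r) ^ 2 + -2 * L ^ 2) / ((t * r) ^ 2 + L ^ 2) ^ ((5 : ℝ) / 2))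
        - (1 * r ^ 2 + -2 * L ^ 2) / (r ^ 2 + L ^ 2) ^ ((5 : ℝ) / 2) ≤
      t ^ 3 * ((9 / 5 * (t * r) ^ 2 + 0 * L ^ 2) / ((t * r) ^ 2 + L ^ 2) ^ ((5 : ℝ) / 2))
        - (9 / 5 * r ^ 2 + 0 * L ^ 2) / (r ^ 2 + L ^ 2) ^ ((5 : ℝ) / 2) := by
  have ht0 : 0 < t := by linarith
  obtain ⟨h0, h1, h2⟩ := sqrt_inv_scale_bounds hL ht hr
  have e := fun a b => quadratic_div_scale hL one_pos hr a b
  simp only [one_pow, one_mul, div_one] at e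
  rw [quadratic_div_scale hL ht0 hr, quadratic_div_scale hL ht0 hr, one_mul, e (9 / 5) 0]
  have e' := e 1 (-2)
  rw [one_mul] at e'
  rw [e']
  have := poly_mono h0 h1 hr.le h2
  linarith

theorem majorant_scale_nonneg {L t r : ℝ} (hL : 0 < L) (ht : 1 < t) (hr : 0 < r) :
    0 ≤ t ^ 3 * ((9 / 5 * (t * r) ^ 2 + 0 * L ^ 2) / ((t * r) ^ 2 + L ^ 2) ^ ((5 : ℝ) / 2))
        - (9 / 5 * r ^ 2 + 0 * L ^ 2) / (r ^ 2 + L ^ 2) ^ ((5 : ℝ) / 2) := by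
  have ht0 : 0 < t := by linarith
  obtain ⟨h0, h1, h2⟩ := sqrt_inv_scale_bounds hL ht hr
  have e := quadratic_div_scale hL one_pos hr (9 / 5) 0
  simp only [one_pow, one_mul, div_one] at e
  rw [quadratic_div_scale hL ht0 hr, e]
  have := pow_le_pow_left₀ h0 h1 5
  have := mul_le_mul_of_nonneg_left this (show 0 ≤ 9 / 5 * r ^ 2 by positivity)
  linarith

theorem gdel_scale_nonneg {δ t : ℝ} (ht : 1 < t) {r : ℝ} (hr : 0 < r) :
    0 ≤ t ^ 3 * (gdel δ (t * r) / (t * r) ^ 3) - gdel δ r / r ^ 3 := by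
  have ht0 : 0 < t := by linarith
  have e : t ^ 3 * (gdel δ (t * r) / (t * r) ^ 3) = gdel δ (t * r) / r ^ 3 := by field_simp
  rw [e, sub_nonneg]
  gcongr
  unfold gdel
  have : r ≤ t * r := by nlinarith
  split_ifs <;> linarith

theorem gdel_scale_pos {δ t : ℝ} (hδ : 0 < δ) (ht : 1 < t) {r : ℝ} (h1 : δ / t < r) (h2 : r < δ) :
    0 < t ^ 3 * (gdel δ (t * r) / (t * r) ^ 3) - gdel δ r / r ^ 3 := by
  have ht0 : 0 < t := by linarith
  have hr : 0 < r := (div_pos hδ ht0).trans h1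
  have h3 : δ < t * r := by rwa [div_lt_iff₀ ht0, mul_comm] at h1
  simp only [gdel, h3, h2.not_gt, if_true, if_false, zero_div, sub_zero]
  positivity

theorem integral_shiftDiff_scale_lt {Ω : Set Plane} (hΩ : MeasurableSet Ω) (hv : volume Ω ≠ ⊤)
    (hv0 : volume Ω ≠ 0) {δ t : ℝ} (hδ : 0 < δ) (ht : 1 < t) {K G Q : Plane → ℝ}
    (hG : Integrable G) (hQ : Integrable Q)
    (hGQ : ∀ z, z ≠ 0 → t ^ 3 * G (t • z) - G z ≤ t ^ 3 * Q (t • z) - Q z)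
    (hQ0 : ∀ z, z ≠ 0 → 0 ≤ t ^ 3 * Q (t • z) - Q z)
    (hK : ∀ z, K z = gdel δ ‖z‖ / ‖z‖ ^ 3 - G z) :
    (∫ z, shiftDiff Ω z * K z) - 2 * volume.real Ω * ((t - 1) * ∫ z, Q z) <
      t ^ 3 * ∫ z, shiftDiff Ω z * K (t • z) := by
  have ht0 : 0 < t := by linarith
  set P : Plane → ℝ := fun z => gdel δ ‖z‖ / ‖z‖ ^ 3 with hPdef
  have hP : Integrable P := integrable_gdel_div hδ
  have hKi : Integrable K := (hP.sub hG).congr (Eventually.of_forall fun z => (hK z).symm)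
  have hscale : ∀ {k : Plane → ℝ}, Integrable k →
      Integrable fun z => t ^ 3 * k (t • z) - k z := fun hk =>
    ((hk.comp_smul ht0.ne').const_mul _).sub hk
  have hPz : ∀ z, t ^ 3 * P (t • z) - P z =
      t ^ 3 * (gdel δ (t * ‖z‖) / (t * ‖z‖) ^ 3) - gdel δ ‖z‖ / ‖z‖ ^ 3 := by
    intro z
    simp only [hPdef, norm_smul, Real.norm_of_nonneg ht0.le]
  have hP0 : ∀ z, 0 ≤ t ^ 3 * P (t • z) - P z := by
    intro z
    rw [hPz]
    rcases (norm_nonneg z).eq_or_lt with h | h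
    · simp [← h]
    · exact gdel_scale_nonneg ht h
  have hpos : 0 < ∫ z, shiftDiff Ω z * (t ^ 3 * P (t • z) - P z) := by
    rw [integral_pos_iff_support_of_nonneg
      (fun z => mul_nonneg (shiftDiff_nonneg Ω z) (hP0 z))
      (integrable_shiftDiff_mul hΩ hv (hscale hP))]
    have hopen : IsOpen {z : Plane | δ / t < ‖z‖ ∧ ‖z‖ < δ} :=
      (isOpen_lt continuous_const continuous_norm).inter
        (isOpen_lt continuous_norm continuous_const)
    have hlt : δ / t < δ := div_lt_self hδ ht
    have hne : {z : Plane | δ / t < ‖z‖ ∧ ‖z‖ < δ}.Nonempty := by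
      obtain ⟨c, hc1, hc2⟩ := exists_between hlt
      have hc : 0 < c := (div_pos hδ ht0).trans hc1
      exact ⟨EuclideanSpace.single 0 c, by simpa [abs_of_pos hc] using ⟨hc1, hc2⟩⟩
    refine (hopen.measure_pos volume hne).trans_le (measure_mono fun z hz => ?_)
    have hz0 : z ≠ 0 := norm_pos_iff.1 ((div_pos hδ ht0).trans hz.1)
    refine (mul_pos (shiftDiff_pos hΩ hv hv0 hz0) ?_).ne'
    rw [hPz]
    exact gdel_scale_pos hδ ht hz.1 hz.2
  have hQint : ∫ z, (t ^ 3 * Q (t • z) - Q z) = (t - 1) * ∫ z, Q z := by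
    rw [integral_sub ((hQ.comp_smul ht0.ne').const_mul _) hQ, integral_const_mul,
      Measure.integral_comp_smul]
    simp only [finrank_euclideanSpace, Fintype.card_fin, smul_eq_mul,
      abs_of_pos (inv_pos.2 (pow_pos ht0 2))]
    field_simp
  have hKint : ∫ z, shiftDiff Ω z * (t ^ 3 * K (t • z) - K z) =
      t ^ 3 * (∫ z, shiftDiff Ω z * K (t • z)) - ∫ z, shiftDiff Ω z * K z := by
    rw [← integral_const_mul, ← integral_sub
      ((integrable_shiftDiff_mul hΩ hv (hKi.comp_smul ht0.ne')).const_mul _)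
      (integrable_shiftDiff_mul hΩ hv hKi)]
    congr 1
    ext z
    ring
  have hle : ∫ z, (shiftDiff Ω z * (t ^ 3 * P (t • z) - P z)
        - 2 * volume.real Ω * (t ^ 3 * Q (t • z) - Q z)) ≤
      ∫ z, shiftDiff Ω z * (t ^ 3 * K (t • z) - K z) := by
    refine integral_mono_ae ((integrable_shiftDiff_mul hΩ hv (hscale hP)).sub
      ((hscale hQ).const_mul _)) (integrable_shiftDiff_mul hΩ hv (hscale hKi)) ?_
    filter_upwards [Measure.ae_ne volume (0 : Plane)] with z hz
    have h1 := mul_le_mul_of_nonneg_left (hGQ z hz) (shiftDiff_nonneg Ω z)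
    have h2 := mul_le_mul_of_nonneg_right (shiftDiff_le hΩ hv z) (hQ0 z hz)
    have h3 : t ^ 3 * K (t • z) - K z =
        (t ^ 3 * P (t • z) - P z) - (t ^ 3 * G (t • z) - G z) := by
      rw [hK, hK]; ring
    rw [h3, mul_sub]
    linarith
  rw [integral_sub (integrable_shiftDiff_mul hΩ hv (hscale hP)) ((hscale hQ).const_mul _),
    integral_const_mul, hQint, hKint] at hle
  linarith

/-- The dipolar correction term of the kernel. -/
noncomputable def dipoleCorr (l : ℝ≥0∞) (z : Plane) : ℝ :=
  if l = ⊤ then 0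
  else (‖z‖ ^ 2 - 2 * l.toReal ^ 2) / (‖z‖ ^ 2 + l.toReal ^ 2) ^ ((5 : ℝ) / 2)

theorem integrable_dipoleCorr {l : ℝ≥0∞} (hl : 0 < l) : Integrable (dipoleCorr l) := by
  by_cases h : l = ⊤
  · simp only [funext fun z => show dipoleCorr l z = 0 by simp [dipoleCorr, h]]
    exact integrable_zero _ _ _
  · refine (integrable_quadratic_div (ENNReal.toReal_pos hl.ne' h) 1 (-2)).congr
      (Eventually.of_forall fun z => ?_)
    simp only [dipoleCorr, h, if_false]
    ring_nf

theorem integrable_Kker {δ : ℝ} (hδ : 0 < δ) {l : ℝ≥0∞} (hl : 0 < l) :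
    Integrable fun z : Plane => Kker δ l ‖z‖ :=
  (integrable_gdel_div hδ).sub (integrable_dipoleCorr hl)

theorem integral_shiftDiff_Kker_scale_lt {Ω : Set Plane} (hΩ : MeasurableSet Ω)
    (hv : volume Ω ≠ ⊤) (hv0 : volume Ω ≠ 0) {δ t : ℝ} (hδ : 0 < δ) (ht : 1 < t) {l : ℝ≥0∞}
    (hl : 0 < l) :
    (∫ z, shiftDiff Ω z * Kker δ l ‖z‖) -
        2 * volume.real Ω * ((t - 1) * if l = ⊤ then 0 else 12 * π / (5 * l.toReal)) <
      t ^ 3 * ∫ z, shiftDiff Ω z * Kker δ l ‖t • z‖ := by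
  by_cases h : l = ⊤
  · have := integral_shiftDiff_scale_lt hΩ hv hv0 hδ ht (K := fun z => Kker δ l ‖z‖)
      (G := fun _ => 0) (Q := fun _ => 0) (integrable_zero _ _ _) (integrable_zero _ _ _)
      (by simp) (by simp) (by simp [Kker, h])
    simpa [h] using this
  · have hL : 0 < l.toReal := ENNReal.toReal_pos hl.ne' h
    have ht0 : 0 < t := by linarith
    have := integral_shiftDiff_scale_lt hΩ hv hv0 hδ ht (K := fun z => Kker δ l ‖z‖)
      (integrable_quadratic_div hL 1 (-2)) (integrable_quadratic_div hL (9 / 5) 0)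
      (fun z hz => by
        simp only [norm_smul, Real.norm_of_nonneg ht0.le]
        exact dipole_scale_le hL ht (norm_pos_iff.2 hz))
      (fun z hz => by
        simp only [norm_smul, Real.norm_of_nonneg ht0.le]
        exact majorant_scale_nonneg hL ht (norm_pos_iff.2 hz))
      (fun z => by simp only [Kker, h, if_false]; ring_nf)
    rw [integral_majorant hL] at this
    simpa only [h, if_false] using this

open scoped Pointwise in
theorem ind_smul_smul {Ω : Set Plane} {t : ℝ} (ht : t ≠ 0) (x : Plane) :
    ind (t • Ω) (t • x) = ind Ω x := by
  by_cases h : x ∈ Ω <;> simp [ind, Set.smul_mem_smul_set_iff₀ ht, h]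

open scoped Pointwise in
theorem nonlocal_smul (Ω : Set Plane) {t : ℝ} (ht : 0 < t) (k : ℝ → ℝ) :
    ∫ x : Plane, ∫ z : Plane, |ind (t • Ω) (x + z) - ind (t • Ω) x| ^ 2 * k ‖z‖ =
      t ^ 4 * ∫ x : Plane, ∫ z : Plane, |ind Ω (x + z) - ind Ω x| ^ 2 * k ‖t • z‖ := by
  have hsub : ∀ f : Plane → ℝ, ∫ x, f x = t ^ 2 * ∫ x, f (t • x) := by
    intro f
    rw [Measure.integral_comp_smul]
    simp only [finrank_euclideanSpace, Fintype.card_fin, smul_eq_mul,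
      abs_of_pos (inv_pos.2 (pow_pos ht 2))]
    field_simp
  rw [hsub]
  have : ∀ x : Plane,
      ∫ z : Plane, |ind (t • Ω) (t • x + z) - ind (t • Ω) (t • x)| ^ 2 * k ‖z‖ =
        t ^ 2 * ∫ z : Plane, |ind Ω (x + z) - ind Ω x| ^ 2 * k ‖t • z‖ := by
    intro x
    rw [hsub]
    simp only [← smul_add, ind_smul_smul ht.ne']
  simp only [this, integral_const_mul]
  ring

open scoped Pointwise in
/-- The strict rescaling inequality for the shifted energy under dilation by `t > 1`. -/
theorem Fenergy_smul_lt {lam δ : ℝ} {l : ℝ≥0∞} (hlam : 0 < lam) (hδ0 : 0 < δ) (hδ1 : δ < 1)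
    (hl : 0 < l) {Ω : Set Plane} (hΩ : MeasurableSet Ω) (hfin : HasFinPer Ω) {m : ℝ}
    (hm : 0 < m) (hvol : volume Ω = ENNReal.ofReal m) {t : ℝ} (ht : 1 < t) :
    Fenergy lam δ l (t • Ω) - cconst lam δ l * (t ^ 2 * m) <
      t * (Fenergy lam δ l Ω - cconst lam δ l * m) := by
  have ht0 : 0 < t := by linarith
  have hlog : 0 < |Real.log δ| := abs_pos.2 (Real.log_neg hδ0 hδ1).ne
  have hv : volume Ω ≠ ⊤ := by simp [hvol]
  have hv0 : volume Ω ≠ 0 := by simpa [hvol] using hm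
  have hreal : volume.real Ω = m := by simp [Measure.real, hvol, hm.le]
  have hper := (perim_smul_le hfin ht0).2
  have hK := integrable_Kker hδ0 hl
  have hmain := integral_shiftDiff_Kker_scale_lt hΩ hv hv0 hδ0 ht hl
  have hc : cconst lam δ l = lam / (4 * |Real.log δ|) *
      (2 * if l = ⊤ then 0 else 12 * π / (5 * l.toReal)) := by
    unfold cconst
    split_ifs with h
    · simp
    · have := (ENNReal.toReal_pos hl.ne' h).ne'
      field_simp
      ring
  have hκ : 0 < lam / (4 * |Real.log δ|) := by positivity
  unfold Fenergy
  rw [nonlocal_smul Ω ht0, integral_sq_ind_sub_mul hΩ hv hK,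
    integral_sq_ind_sub_mul hΩ hv (k := fun z => Kker δ l ‖t • z‖) (hK.comp_smul ht0.ne'), hc]
  rw [hreal] at hmain
  have := mul_lt_mul_of_pos_left hmain (mul_pos hκ ht0)
  linarith

theorem Fenergy_lower_bound {lam δ : ℝ} {l : ℝ≥0∞} (hlam : 0 < lam) (hδ0 : 0 < δ) (hl : 0 < l)
    {Ω : Set Plane} (hΩ : MeasurableSet Ω) (hfin : HasFinPer Ω) (hv : volume Ω ≠ ⊤) :
    -(lam / (4 * |Real.log δ|) * (2 * volume.real Ω * ∫ z : Plane, |Kker δ l ‖z‖|)) ≤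
      Fenergy lam δ l Ω := by
  have hK := integrable_Kker hδ0 hl
  have hper := perim_nonneg hfin
  have hle : ∫ z, shiftDiff Ω z * Kker δ l ‖z‖ ≤
      2 * volume.real Ω * ∫ z : Plane, |Kker δ l ‖z‖| := by
    rw [← integral_const_mul]
    refine integral_mono (integrable_shiftDiff_mul hΩ hv hK) (hK.abs.const_mul _) fun z => ?_
    exact (mul_le_mul_of_nonneg_left (le_abs_self _) (shiftDiff_nonneg Ω z)).trans
      (mul_le_mul_of_nonneg_right (shiftDiff_le hΩ hv z) (abs_nonneg _))
  unfold Fenergy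
  rw [integral_sq_ind_sub_mul hΩ hv hK]
  have := mul_le_mul_of_nonneg_left hle (show 0 ≤ lam / (4 * |Real.log δ|) by positivity)
  linarith

theorem fmin_le {lam δ : ℝ} {l : ℝ≥0∞} (hlam : 0 < lam) (hδ0 : 0 < δ) (hl : 0 < l) {m : ℝ}
    {Ω : Set Plane} (hΩ : MeasurableSet Ω) (hfin : HasFinPer Ω)
    (hvol : volume Ω = ENNReal.ofReal m) :
    fmin lam δ l m ≤ Fenergy lam δ l Ω - cconst lam δ l * m := by
  unfold fmin
  refine sub_le_sub_right (csInf_le ?_ ?_) _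
  swap
  · exact ⟨Ω, hΩ, hfin, hvol, rfl⟩
  refine ⟨-(lam / (4 * |Real.log δ|) *
    (2 * (ENNReal.ofReal m).toReal * ∫ z : Plane, |Kker δ l ‖z‖|)), ?_⟩
  rintro s ⟨Ω', hΩ', hfin', hvol', rfl⟩
  have := Fenergy_lower_bound (lam := lam) hlam hδ0 hl hΩ' hfin' (by simp [hvol'])
  rwa [Measure.real, hvol'] at this

open scoped Pointwise in
theorem volume_smul_eq {Ω : Set Plane} {m t : ℝ} (ht : 0 < t)
    (hvol : volume Ω = ENNReal.ofReal m) : volume (t • Ω) = ENNReal.ofReal (t ^ 2 * m) := by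
  rw [Measure.addHaar_smul, hvol, finrank_euclideanSpace, Fintype.card_fin,
    abs_of_pos (pow_pos ht 2), ENNReal.ofReal_mul (by positivity)]

open scoped Pointwise in
theorem fmin_lt_of_dilation {lam δ : ℝ} {l : ℝ≥0∞} (hlam : 0 < lam) (hδ0 : 0 < δ) (hδ1 : δ < 1)
    (hl : 0 < l) {Ω : Set Plane} (hΩ : MeasurableSet Ω) (hfin : HasFinPer Ω) {m : ℝ}
    (hm : 0 < m) (hvol : volume Ω = ENNReal.ofReal m) {t : ℝ} (ht : 1 < t) :
    fmin lam δ l (t ^ 2 * m) < t * (Fenergy lam δ l Ω - cconst lam δ l * m) := by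
  have ht0 : 0 < t := by linarith
  refine (fmin_le hlam hδ0 hl (hΩ.const_smul_of_ne_zero ht0.ne') (perim_smul_le hfin ht0).1
    (volume_smul_eq ht0 hvol)).trans_lt (Fenergy_smul_lt hlam hδ0 hδ1 hl hΩ hfin hm hvol ht)

theorem exists_dilation_factor {m₁ m₂ : ℝ} (h1 : 0 < m₁) (h : m₁ < m₂) :
    ∃ t : ℝ, 1 < t ∧ t ^ 2 * m₁ = m₂ := by
  have hq : 1 < m₂ / m₁ := (one_lt_div h1).2 h
  refine ⟨√(m₂ / m₁), by rwa [Real.lt_sqrt zero_le_one, one_pow], ?_⟩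
  rw [Real.sq_sqrt (by linarith)]
  field_simp

open scoped Pointwise in
theorem exists_dilate {Ω : Set Plane} (hΩ : MeasurableSet Ω) (hfin : HasFinPer Ω) {m₁ m₂ : ℝ}
    (hm : 0 < m₁) (hvol : volume Ω = ENNReal.ofReal m₁) (h : m₁ < m₂) :
    ∃ Ω' : Set Plane, MeasurableSet Ω' ∧ HasFinPer Ω' ∧ volume Ω' = ENNReal.ofReal m₂ := by
  obtain ⟨t, ht, rfl⟩ := exists_dilation_factor hm h
  have ht0 : 0 < t := by linarith
  exact ⟨t • Ω, hΩ.const_smul_of_ne_zero ht0.ne', (perim_smul_le hfin ht0).1,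
    volume_smul_eq ht0 hvol⟩

/-- If `f(m₀) = 0` and a minimizer at mass `m₀` exists, then `f` is
negative beyond `m₀` and strictly decreasing on `(m₀, ∞)`. -/
theorem stmt19 (lam δ : ℝ) (l : ℝ≥0∞) (hlam : 0 < lam) (hδ0 : 0 < δ) (hδ : δ < 1 / 2)
    (hl : 0 < l) (m₀ : ℝ) (hm₀ : 0 < m₀) (hf0 : fmin lam δ l m₀ = 0)
    (Ω : Set Plane) (hmeas : MeasurableSet Ω) (hfin : HasFinPer Ω)
    (hvol : volume Ω = ENNReal.ofReal m₀)
    (hmin : ∀ Ω' : Set Plane, MeasurableSet Ω' → HasFinPer Ω' →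
      volume Ω' = ENNReal.ofReal m₀ → Fenergy lam δ l Ω ≤ Fenergy lam δ l Ω') :
    (∀ m : ℝ, m₀ < m → fmin lam δ l m < 0) ∧
      StrictAntiOn (fmin lam δ l) (Set.Ioi m₀) := by

  have hδ1 : δ < 1 := by linarith
  have hF0 : Fenergy lam δ l Ω - cconst lam δ l * m₀ = 0 := by
    refine le_antisymm ?_ (hf0 ▸ fmin_le hlam hδ0 hl hmeas hfin hvol)
    rw [← hf0]
    unfold fmin
    refine sub_le_sub_right (le_csInf ?_ ?_) _
    · exact ⟨_, Ω, hmeas, hfin, hvol, rfl⟩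
    rintro s ⟨Ω', h1, h2, h3, rfl⟩
    exact hmin Ω' h1 h2 h3
  have hneg : ∀ m : ℝ, m₀ < m → fmin lam δ l m < 0 := by
    intro m hm
    obtain ⟨t, ht, rfl⟩ := exists_dilation_factor hm₀ hm
    simpa [hF0] using fmin_lt_of_dilation hlam hδ0 hδ1 hl hmeas hfin hm₀ hvol ht
  refine ⟨hneg, fun m₁ h1 m₂ _ h12 => ?_⟩
  have hm₁ : 0 < m₁ := hm₀.trans h1
  obtain ⟨t, ht, rfl⟩ := exists_dilation_factor hm₁ h12
  have ht0 : 0 < t := by linarith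
  have hle : fmin lam δ l (t ^ 2 * m₁) / t + cconst lam δ l * m₁ ≤
      sInf {s | ∃ Ω : Set Plane, MeasurableSet Ω ∧ HasFinPer Ω ∧
        volume Ω = ENNReal.ofReal m₁ ∧ s = Fenergy lam δ l Ω} := by
    obtain ⟨Ω₁, hmeas', hfin', hvol'⟩ := exists_dilate hmeas hfin hm₀ hvol h1
    refine le_csInf ⟨_, _, hmeas', hfin', hvol', rfl⟩ ?_
    · rintro s ⟨Ω', h1', h2', h3', rfl⟩
      have := (fmin_lt_of_dilation hlam hδ0 hδ1 hl h1' h2' hm₁ h3' ht).le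
      rw [← div_le_iff₀' ht0] at this
      linarith
  have hstep : fmin lam δ l (t ^ 2 * m₁) ≤ t * fmin lam δ l m₁ := by
    rw [← div_le_iff₀' ht0]
    unfold fmin at hle ⊢
    linarith
  have := hneg m₁ h1
  nlinarith
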